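/- (Generalized quintuple product identity) For any positive integer a, |q| < 1, and z ≠ 0 avoiding poles: [z^a;q]_∞ / ([z;q]_∞ [z^{a+1};q]_∞) = (E(q^{a+1})² / E(q)²) · ∑_{j=0}^{a-1} z^j [q^{a-j}; q^{a+1}]_∞ / ([z^{a+1}; q^{a+1}]_∞ [z^{a+1} q^{a-j}; q^{a+1}]_∞). -/

import Mathlib

/-- `E(q) = ∏_{n ≥ 1} (1 - qⁿ)`. -/
noncomputable def Eprod (q : ℂ) : ℂ := ∏' n : ℕ, (1 - q ^ (n + 1))

/-- `[z;q]_∞ = ∏_{n ≥ 1} (1 - z q^{n-1})(1 - z⁻¹ qⁿ)`. -/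
noncomputable def brkt (z q : ℂ) : ℂ := ∏' n : ℕ, (1 - z * q ^ n) * (1 - z⁻¹ * q ^ (n + 1))

open Filter Topology

/-- The finite `q`-Pochhammer symbol `(x; q)_n`. -/
noncomputable def qPoch (x q : ℂ) (n : ℕ) : ℂ := ∏ k ∈ Finset.range n, (1 - x * q ^ k)

/-- The infinite `q`-Pochhammer symbol `(x; q)_∞`. -/
noncomputable def qPochInf (x q : ℂ) : ℂ := ∏' k : ℕ, (1 - x * q ^ k)

section Products

variable {q : ℂ}

lemma summable_norm_neg_mul_pow (hq : ‖q‖ < 1) (x : ℂ) :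
    Summable fun k : ℕ ↦ ‖-(x * q ^ k)‖ := by
  simpa using (summable_geometric_of_lt_one (norm_nonneg q) hq).mul_left ‖x‖

lemma multipliable_one_sub_mul_pow (hq : ‖q‖ < 1) (x : ℂ) :
    Multipliable fun k : ℕ ↦ 1 - x * q ^ k := by
  simpa [sub_eq_add_neg] using
    multipliable_one_add_of_summable (summable_norm_neg_mul_pow hq x)

lemma tendsto_qPoch (hq : ‖q‖ < 1) (x : ℂ) :
    Tendsto (qPoch x q) atTop (𝓝 (qPochInf x q)) :=
  (multipliable_one_sub_mul_pow hq x).hasProd.tendsto_prod_nat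

lemma qPochInf_ne_zero (hq : ‖q‖ < 1) {x : ℂ} (hx : ∀ k : ℕ, 1 - x * q ^ k ≠ 0) :
    qPochInf x q ≠ 0 := by
  simpa [sub_eq_add_neg, qPochInf] using
    tprod_one_add_ne_zero_of_summable (f := fun k : ℕ ↦ -(x * q ^ k))
      (by simpa [sub_eq_add_neg] using hx) (summable_norm_neg_mul_pow hq x)

lemma qPochInf_ne_zero_of_norm_lt_one (hq : ‖q‖ < 1) {x : ℂ} (hx : ‖x‖ < 1) :
    qPochInf x q ≠ 0 := by
  refine qPochInf_ne_zero hq fun k h ↦ ?_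
  have h1 : ‖x * q ^ k‖ = 1 := by rw [← sub_eq_zero.mp h, norm_one]
  rw [norm_mul, norm_pow] at h1
  have := mul_le_of_le_one_right (norm_nonneg x) (pow_le_one₀ (n := k) (norm_nonneg q) hq.le)
  linarith

lemma Eprod_eq_qPochInf (q : ℂ) : Eprod q = qPochInf q q := by
  simp only [Eprod, qPochInf, pow_succ']

lemma Eprod_ne_zero (hq : ‖q‖ < 1) : Eprod q ≠ 0 := by
  rw [Eprod_eq_qPochInf]
  exact qPochInf_ne_zero_of_norm_lt_one hq hq

lemma brkt_eq_mul (hq : ‖q‖ < 1) (z : ℂ) :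
    brkt z q = qPochInf z q * qPochInf (q / z) q := by
  rw [brkt, qPochInf, qPochInf, ← (multipliable_one_sub_mul_pow hq z).tprod_mul
    (multipliable_one_sub_mul_pow hq (q / z))]
  congr! 4
  ring

lemma brkt_one (q : ℂ) : brkt 1 q = 0 :=
  tprod_of_exists_eq_zero ⟨0, by simp⟩

lemma brkt_zero_right (z : ℂ) : brkt z 0 = 1 - z := by
  rw [brkt, tprod_eq_mulSingle 0]
  · simp
  · intro n hn
    simp [hn]

lemma qPochInf_eq_one_sub_mul (hq : ‖q‖ < 1) (x : ℂ) :
    qPochInf x q = (1 - x) * qPochInf (x * q) q := by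
  have h := multipliable_one_sub_mul_pow hq (x * q)
  simp only [mul_assoc, ← pow_succ'] at h
  have h' := tprod_eq_zero_mul' (f := fun k : ℕ ↦ 1 - x * q ^ k) h
  simpa only [qPochInf, mul_assoc, ← pow_succ', pow_zero, mul_one] using h'

lemma brkt_inv (hq : ‖q‖ < 1) {z : ℂ} (hz : z ≠ 0) : brkt z⁻¹ q = -z⁻¹ * brkt z q := by
  rw [brkt_eq_mul hq, brkt_eq_mul hq, qPochInf_eq_one_sub_mul hq z⁻¹,
    qPochInf_eq_one_sub_mul hq z, div_inv_eq_mul, mul_comm q z, inv_mul_eq_div]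
  field_simp
  ring

lemma differentiable_qPochInf (hq : ‖q‖ < 1) : Differentiable ℂ fun x ↦ qPochInf x q := by
  intro x₀
  have hloc : HasProdLocallyUniformlyOn (fun (k : ℕ) x ↦ 1 + -(x * q ^ k))
      (fun x ↦ ∏' k : ℕ, (1 + -(x * q ^ k))) (Metric.ball (0 : ℂ) (‖x₀‖ + 1)) := by
    refine Summable.hasProdLocallyUniformlyOn_nat_one_add Metric.isOpen_ball
      ((summable_geometric_of_lt_one (norm_nonneg q) hq).mul_left (‖x₀‖ + 1))
      (.of_forall fun k x hx ↦ ?_) fun k ↦ by fun_prop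
    rw [norm_neg, norm_mul, norm_pow]
    gcongr
    simpa using (Metric.mem_ball.mp hx).le
  have hd := hloc.differentiableOn (.of_forall fun s ↦ by
    simpa [Finset.prod_fn] using DifferentiableOn.finsetProd (fun _ _ ↦ by fun_prop))
    Metric.isOpen_ball
  simp only [← sub_eq_add_neg] at hd
  exact hd.differentiableAt (Metric.isOpen_ball.mem_nhds (by simp))

lemma differentiableOn_brkt (hq : ‖q‖ < 1) : DifferentiableOn ℂ (fun z ↦ brkt z q) {0}ᶜ := by
  simp only [brkt_eq_mul hq]
  refine (differentiable_qPochInf hq).differentiableOn.mul ?_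
  exact (differentiable_qPochInf hq).comp_differentiableOn
    (DifferentiableOn.div (by fun_prop) (by fun_prop) fun z hz ↦ hz)

end Products

section FiniteIdentity

variable {q : ℂ}

lemma prod_one_sub_mul_pow_div_pow (hq : q ≠ 0) {x : ℂ} (hx : x ≠ 0) (n : ℕ) :
    ∏ k ∈ Finset.range n, (1 - x * q ^ k / q ^ n) =
      (-x) ^ n * (∏ k ∈ Finset.range n, (q ^ (k + 1))⁻¹) * qPoch (q / x) q n := by
  have hconst : (-x) ^ n = ∏ k ∈ Finset.range n, -x := by simp
  rw [← Finset.prod_range_reflect, qPoch, hconst, ← Finset.prod_mul_distrib,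
    ← Finset.prod_mul_distrib]
  refine Finset.prod_congr rfl fun k hk ↦ ?_
  obtain ⟨m, rfl⟩ := Nat.exists_eq_add_of_lt (Finset.mem_range.mp hk)
  rw [show k + m + 1 - 1 - k = m by omega]
  field_simp
  ring

lemma prod_erase_one_sub_pow_div_pow (hq : q ≠ 0) (i m : ℕ) :
    ∏ k ∈ (Finset.range (i + m + 1)).erase i, (1 - q ^ k / q ^ i) =
      (-1) ^ i * (∏ k ∈ Finset.range i, (q ^ (k + 1))⁻¹) * qPoch q q i * qPoch q q m := by
  have h := prod_one_sub_mul_pow_div_pow hq one_ne_zero i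
  simp only [one_mul, div_one] at h
  rw [← h, ← Finset.prod_congr rfl (g := fun k ↦ 1 - q ^ k / q ^ i)
    (f := fun k ↦ if k = i then 1 else 1 - q ^ k / q ^ i)
    (fun k hk ↦ if_neg (Finset.ne_of_mem_erase hk)), Finset.prod_erase (f := fun k ↦ if k = i then 1 else 1 - q ^ k / q ^ i) _ (if_pos rfl),
    add_assoc, Finset.prod_range_add, Finset.prod_range_succ', qPoch]
  simp only [add_zero, if_true, mul_one]
  congr 1
  · exact Finset.prod_congr rfl fun k hk ↦ if_neg (Finset.mem_range.mp hk).ne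
  · refine Finset.prod_congr rfl fun k hk ↦ ?_
    rw [if_neg (by omega)]
    field_simp
    ring

lemma prod_one_sub_div_pow_mul_pow (hq : q ≠ 0) {x : ℂ} (hx : x ≠ 0) (n m : ℕ) :
    qPoch (x / q ^ n) q (n + m) =
      (-x) ^ n * (∏ k ∈ Finset.range n, (q ^ (k + 1))⁻¹) * qPoch (q / x) q n * qPoch x q m := by
  rw [← prod_one_sub_mul_pow_div_pow hq hx, qPoch, Finset.prod_range_add, qPoch]
  congr 1
  · exact Finset.prod_congr rfl fun k _ ↦ by ring
  · refine Finset.prod_congr rfl fun k _ ↦ ?_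
    field_simp
    ring

lemma qPoch_self_ne_zero (hq : ‖q‖ < 1) (n : ℕ) : qPoch q q n ≠ 0 := by
  refine Finset.prod_ne_zero_iff.mpr fun k _ h ↦ ?_
  have h1 : ‖q ^ (k + 1)‖ = 1 := by rw [pow_succ', ← sub_eq_zero.mp h, norm_one]
  rw [norm_pow] at h1
  exact (pow_lt_one₀ (norm_nonneg q) hq k.succ_ne_zero).ne h1

/-- Partial fraction expansion of `(xy; q)_M / (y; q)_{M+1}` in `y`. -/
lemma qPoch_mul_div_eq_sum (hq0 : q ≠ 0) (hq : ‖q‖ < 1) {x y : ℂ} (hx : x ≠ 0) (M : ℕ)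
    (hy : ∀ k < M + 1, 1 - y * q ^ k ≠ 0) :
    qPoch (x * y) q M / qPoch y q (M + 1) =
      ∑ i ∈ Finset.range (M + 1), x ^ i * (qPoch x q (M - i) * qPoch (q / x) q i /
        (qPoch q q (M - i) * qPoch q q i)) / (1 - y * q ^ i) := by
  classical
  let f : Polynomial ℂ :=
    ∏ k ∈ Finset.range M, (1 - Polynomial.C (x * q ^ k) * Polynomial.X)
  have hf (t : ℂ) : f.eval t = ∏ k ∈ Finset.range M, (1 - x * q ^ k * t) := by
    simp [f, Polynomial.eval_prod]
  have hinj : Function.Injective fun i : ℕ ↦ (q ^ i)⁻¹ := by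
    refine inv_injective.comp fun i j h ↦ ?_
    have h' : ‖q‖ ^ i = ‖q‖ ^ j := by simpa using congrArg norm h
    exact (pow_right_strictAnti₀ (norm_pos_iff.mpr hq0) hq).injective h'
  have hdeg : f.degree < (Finset.range (M + 1)).card := by
    rw [Finset.card_range]
    refine (Polynomial.degree_prod_le _ _).trans_lt ?_
    refine (Finset.sum_le_card_nsmul _ _ 1 fun k _ ↦ ?_).trans_lt ?_
    · compute_degree
    · simp
      norm_cast
      omega
  have hint := Lagrange.eq_interpolate (hinj.injOn (s := ↑(Finset.range (M + 1)))) hdeg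
  have heval := congrArg (Polynomial.eval y) hint
  rw [Lagrange.interpolate_apply, Polynomial.eval_finsetSum, hf] at heval
  have hnum : qPoch (x * y) q M = ∏ k ∈ Finset.range M, (1 - x * q ^ k * y) :=
    Finset.prod_congr rfl fun k _ ↦ by ring
  rw [hnum, heval, Finset.sum_div]
  refine Finset.sum_congr rfl fun i hi ↦ ?_
  obtain ⟨m, rfl⟩ := Nat.exists_eq_add_of_le (Nat.lt_succ_iff.mp (Finset.mem_range.mp hi))
  have hbasis : Polynomial.eval y (Lagrange.basis (Finset.range (i + m + 1))
      (fun i : ℕ ↦ (q ^ i)⁻¹) i) = (∏ k ∈ (Finset.range (i + m + 1)).erase i, (1 - y * q ^ k)) /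
        ∏ k ∈ (Finset.range (i + m + 1)).erase i, (1 - q ^ k / q ^ i) := by
    rw [Lagrange.basis, Polynomial.eval_prod, ← Finset.prod_div_distrib]
    refine Finset.prod_congr rfl fun k hk ↦ ?_
    have h1 : (q ^ i)⁻¹ - (q ^ k)⁻¹ ≠ 0 :=
      sub_ne_zero.mpr (hinj.ne (Finset.ne_of_mem_erase hk).symm)
    have h2 : 1 - q ^ k / q ^ i = - q ^ k * ((q ^ i)⁻¹ - (q ^ k)⁻¹) := by
      field_simp
      ring
    simp only [Lagrange.basisDivisor, Polynomial.eval_mul, Polynomial.eval_C,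
      Polynomial.eval_sub, Polynomial.eval_X]
    rw [h2]
    field_simp
    ring
  have hden : qPoch y q (i + m + 1) =
      (1 - y * q ^ i) * ∏ k ∈ (Finset.range (i + m + 1)).erase i, (1 - y * q ^ k) :=
    (Finset.mul_prod_erase _ _ hi).symm
  have hcoeff : f.eval (q ^ i)⁻¹ = (-x) ^ i * (∏ k ∈ Finset.range i, (q ^ (k + 1))⁻¹) *
      qPoch (q / x) q i * qPoch x q m := by
    rw [← prod_one_sub_div_pow_mul_pow hq0 hx, hf]
    exact Finset.prod_congr rfl fun k _ ↦ by ring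
  have hne : ∏ k ∈ (Finset.range (i + m + 1)).erase i, (1 - y * q ^ k) ≠ 0 :=
    Finset.prod_ne_zero_iff.mpr fun k hk ↦
      hy k (Finset.mem_range.mp (Finset.mem_of_mem_erase hk))
  have hqne : ∏ k ∈ Finset.range i, (q ^ (k + 1))⁻¹ ≠ 0 :=
    Finset.prod_ne_zero_iff.mpr fun k _ ↦ by positivity
  rw [Polynomial.eval_mul, Polynomial.eval_C, hbasis, hden, hcoeff,
    prod_erase_one_sub_pow_div_pow hq0, Nat.add_sub_cancel_left, neg_pow x]
  have := hy i (by omega)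
  have := qPoch_self_ne_zero hq i
  have := qPoch_self_ne_zero hq m
  generalize ∏ k ∈ Finset.range i, (q ^ (k + 1))⁻¹ = Q at hqne ⊢
  field_simp

/-- The bilateral form of `qPoch_mul_div_eq_sum`. -/
lemma qPoch_mul_div_eq_sum_Icc (hq0 : q ≠ 0) (hq : ‖q‖ < 1) {x y : ℂ} (hx : x ≠ 0) (hy0 : y ≠ 0)
    (hy : ∀ n : ℤ, 1 - y * q ^ n ≠ 0) (N : ℕ) :
    qPoch (x * y) q N * qPoch (q / (x * y)) q N / (qPoch y q (N + 1) * qPoch (q / y) q N) =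
      ∑ n ∈ Finset.Icc (-N : ℤ) N, x ^ n * (qPoch x q (N - n).toNat *
        qPoch (q / x) q (N + n).toNat / (qPoch q q (N - n).toNat * qPoch q q (N + n).toNat)) /
          (1 - y * q ^ n) := by
  have hshift (k : ℕ) : y / q ^ N * q ^ k = y * q ^ ((k : ℤ) - N) := by
    rw [zpow_sub₀ hq0, zpow_natCast, zpow_natCast]
    ring
  have h := qPoch_mul_div_eq_sum hq0 hq (y := y / q ^ N) hx (N + N)
    fun k _ ↦ by rw [hshift]; exact hy _
  have hqne : ∏ k ∈ Finset.range N, (q ^ (k + 1))⁻¹ ≠ 0 :=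
    Finset.prod_ne_zero_iff.mpr fun k _ ↦ by positivity
  rw [← mul_div_assoc, prod_one_sub_div_pow_mul_pow hq0 (mul_ne_zero hx hy0), add_assoc,
    prod_one_sub_div_pow_mul_pow hq0 hy0] at h
  have hL : qPoch (x * y) q N * qPoch (q / (x * y)) q N / (qPoch y q (N + 1) * qPoch (q / y) q N)
      = (x ^ N)⁻¹ * ((-(x * y)) ^ N * (∏ k ∈ Finset.range N, (q ^ (k + 1))⁻¹) *
        qPoch (q / (x * y)) q N * qPoch (x * y) q N / ((-y) ^ N *
          (∏ k ∈ Finset.range N, (q ^ (k + 1))⁻¹) * qPoch (q / y) q N * qPoch y q (N + 1))) := by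
    rw [show -(x * y) = x * -y by ring, mul_pow]
    have : (-y) ^ N ≠ 0 := pow_ne_zero _ (neg_ne_zero.mpr hy0)
    generalize ∏ k ∈ Finset.range N, (q ^ (k + 1))⁻¹ = Q at hqne ⊢
    field_simp
  rw [hL, h, Finset.mul_sum]
  symm
  refine Finset.sum_nbij' (fun n ↦ (n + N).toNat) (fun i ↦ (i : ℤ) - N) ?_ ?_ ?_ ?_ ?_
  · intro n hn
    simp only [Finset.mem_Icc, Finset.mem_range] at hn ⊢
    omega
  · intro n hn
    simp only [Finset.mem_Icc, Finset.mem_range] at hn ⊢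
    omega
  · intro n hn
    simp only [Finset.mem_Icc] at hn ⊢
    omega
  · intro n hn
    simp
  · intro n hn
    simp only [Finset.mem_Icc] at hn
    obtain ⟨i, hi⟩ := Int.eq_ofNat_of_zero_le (show 0 ≤ n + N by omega)
    obtain rfl : n = i - N := by omega
    rw [hshift, show ((N : ℤ) - (i - N)).toNat = N + N - i by omega,
      show ((N : ℤ) + (i - N)).toNat = i by omega, show ((i : ℤ) - N + N).toNat = i by omega,
      zpow_sub₀ hx, zpow_natCast, zpow_natCast]
    ring

end FiniteIdentity

section Kronecker

variable {q x y : ℂ}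

lemma brkt_ne_zero (hq : ‖q‖ < ‖x‖) (hx : ‖x‖ < 1) : brkt x q ≠ 0 := by
  have hq1 := hq.trans hx
  rw [brkt_eq_mul hq1]
  refine mul_ne_zero (qPochInf_ne_zero_of_norm_lt_one hq1 hx)
    (qPochInf_ne_zero_of_norm_lt_one hq1 ?_)
  rwa [norm_div, div_lt_one ((norm_nonneg q).trans_lt hq)]

lemma exists_norm_le_of_tendsto {u : ℕ → ℂ} {l : ℂ} (hu : Tendsto u atTop (𝓝 l)) :
    ∃ C, ∀ n, ‖u n‖ ≤ C := by
  obtain ⟨C, hC⟩ := (Metric.isBounded_range_of_tendsto u hu).exists_norm_le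
  exact ⟨C, fun n ↦ hC _ ⟨n, rfl⟩⟩

lemma summable_norm_pow_mul_of_tendsto {r : ℂ} (hr : ‖r‖ < 1) {u : ℕ → ℂ} {l : ℂ}
    (hu : Tendsto u atTop (𝓝 l)) : Summable fun n ↦ ‖r ^ n * u n‖ := by
  obtain ⟨C, hC⟩ := exists_norm_le_of_tendsto hu
  refine ((summable_geometric_of_lt_one (norm_nonneg r) hr).mul_right C).of_nonneg_of_le
    (fun n ↦ norm_nonneg _) fun n ↦ ?_
  rw [norm_mul, norm_pow]
  gcongr
  exact hC n

lemma summable_norm_zpow_div (hq0 : q ≠ 0) (hqx : ‖q‖ < ‖x‖) (hx : ‖x‖ < 1) (hy0 : y ≠ 0) :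
    Summable fun n : ℤ ↦ ‖x ^ n / (1 - y * q ^ n)‖ := by
  have hx0 : x ≠ 0 := norm_pos_iff.mp ((norm_nonneg q).trans_lt hqx)
  have hqn := tendsto_pow_atTop_nhds_zero_of_norm_lt_one (hqx.trans hx)
  refine Summable.of_nat_of_neg ?_ ?_
  · have hu : Tendsto (fun n : ℕ ↦ (1 - y * q ^ n)⁻¹) atTop (𝓝 (1 - y * 0)⁻¹) :=
      (tendsto_const_nhds.sub (hqn.const_mul y)).inv₀ (by simp)
    simpa [div_eq_mul_inv] using summable_norm_pow_mul_of_tendsto hx hu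
  · have hu : Tendsto (fun n : ℕ ↦ (q ^ n - y)⁻¹) atTop (𝓝 (0 - y)⁻¹) :=
      (hqn.sub_const y).inv₀ (by simpa using hy0)
    have hr : ‖q / x‖ < 1 := by
      rwa [norm_div, div_lt_one ((norm_nonneg q).trans_lt hqx)]
    refine (summable_norm_pow_mul_of_tendsto hr hu).congr fun n ↦ ?_
    congr 1
    have h : 1 - y * (q ^ n)⁻¹ = (q ^ n - y) * (q ^ n)⁻¹ := by
      field_simp
    rw [zpow_neg, zpow_neg, zpow_natCast, zpow_natCast, h, div_pow]
    field_simp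

/-- Kronecker's bilateral expansion, the case `b = a q` of Ramanujan's `₁ψ₁` summation. -/
lemma hasSum_zpow_div (hq0 : q ≠ 0) (hqx : ‖q‖ < ‖x‖) (hx : ‖x‖ < 1) (hy0 : y ≠ 0)
    (hy : ∀ n : ℤ, y * q ^ n ≠ 1) :
    HasSum (fun n : ℤ ↦ x ^ n / (1 - y * q ^ n))
      (brkt (x * y) q * Eprod q ^ 2 / (brkt x q * brkt y q)) := by
  have hq : ‖q‖ < 1 := hqx.trans hx
  have hx0 : x ≠ 0 := norm_pos_iff.mp ((norm_nonneg q).trans_lt hqx)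
  have hy1 (n : ℤ) : 1 - y * q ^ n ≠ 0 := sub_ne_zero.mpr (hy n).symm
  have hE := Eprod_ne_zero hq
  have hEq := Eprod_eq_qPochInf q
  have hsum := summable_norm_zpow_div hq0 hqx hx hy0
  have hbx := brkt_ne_zero hqx hx
  have hby : brkt y q ≠ 0 := by
    rw [brkt_eq_mul hq]
    refine mul_ne_zero (qPochInf_ne_zero hq fun k ↦ by exact_mod_cast hy1 k)
      (qPochInf_ne_zero hq fun k h ↦ hy (-(k + 1 : ℕ)) ?_)
    rw [zpow_neg, zpow_natCast]
    rw [sub_eq_zero, eq_comm, div_mul_eq_mul_div, div_eq_one_iff_eq hy0] at h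
    rw [pow_succ', h, mul_inv_cancel₀ hy0]
  have hratio (t : ℂ) : Tendsto (fun n ↦ qPoch t q n / qPoch q q n) atTop
      (𝓝 (qPochInf t q / Eprod q)) := by
    rw [hEq] at hE ⊢
    exact (tendsto_qPoch hq t).div (tendsto_qPoch hq q) hE
  obtain ⟨C₁, hC₁⟩ := exists_norm_le_of_tendsto (hratio x)
  obtain ⟨C₂, hC₂⟩ := exists_norm_le_of_tendsto (hratio (q / x))
  let F (N : ℕ) (n : ℤ) : ℂ := if n ∈ Finset.Icc (-N : ℤ) N then
    x ^ n / (1 - y * q ^ n) * ((qPoch x q (N - n).toNat / qPoch q q (N - n).toNat) *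
      (qPoch (q / x) q (N + n).toNat / qPoch q q (N + n).toNat)) else 0
  have hF (N : ℕ) : ∑' n, F N n = qPoch (x * y) q N * qPoch (q / (x * y)) q N /
      (qPoch y q (N + 1) * qPoch (q / y) q N) := by
    rw [qPoch_mul_div_eq_sum_Icc hq0 hq hx0 hy0 hy1,
      tsum_eq_sum (s := Finset.Icc (-N : ℤ) N) fun n hn ↦ if_neg hn]
    refine Finset.sum_congr rfl fun n hn ↦ ?_
    simp only [if_pos hn]
    ring
  have hlim : Tendsto (fun N ↦ ∑' n, F N n) atTop (𝓝 (∑' n : ℤ, x ^ n / (1 - y * q ^ n) *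
      ((qPochInf x q / Eprod q) * (qPochInf (q / x) q / Eprod q)))) := by
    refine tendsto_tsum_of_dominated_convergence (hsum.mul_right (C₁ * C₂)) (fun n ↦ ?_)
      (.of_forall fun N n ↦ ?_)
    · have h₁ : Tendsto (fun N : ℕ ↦ ((N : ℤ) - n).toNat) atTop atTop :=
        tendsto_atTop.mpr fun b ↦ by
          filter_upwards [eventually_ge_atTop (b + n.toNat)] with N hN
          omega
      have h₂ : Tendsto (fun N : ℕ ↦ ((N : ℤ) + n).toNat) atTop atTop :=
        tendsto_atTop.mpr fun b ↦ by
          filter_upwards [eventually_ge_atTop (b + (-n).toNat)] with N hN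
          omega
      refine ((((hratio x).comp h₁).mul ((hratio (q / x)).comp h₂)).const_mul _).congr' ?_
      filter_upwards [eventually_ge_atTop n.natAbs] with N hN
      simp only [F]
      rw [if_pos (Finset.mem_Icc.mpr (by omega))]
      rfl
    · have hC₁' : 0 ≤ C₁ := (norm_nonneg _).trans (hC₁ 0)
      have hC₂' : 0 ≤ C₂ := (norm_nonneg _).trans (hC₂ 0)
      simp only [F]
      split_ifs
      · rw [norm_mul, norm_mul _ (qPoch (q / x) q _ / _)]
        gcongr
        · exact hC₁ _
        · exact hC₂ _
      · rw [norm_zero]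
        positivity
  have hlim' : Tendsto (fun N ↦ ∑' n, F N n) atTop
      (𝓝 (brkt (x * y) q / brkt y q)) := by
    simp only [hF]
    rw [brkt_eq_mul hq y] at hby ⊢
    rw [brkt_eq_mul hq (x * y)]
    exact ((tendsto_qPoch hq _).mul (tendsto_qPoch hq _)).div
      (((tendsto_qPoch hq _).comp (tendsto_add_atTop_nat 1)).mul (tendsto_qPoch hq _)) hby
  have hmain := tendsto_nhds_unique hlim hlim'
  rw [tsum_mul_right, div_mul_div_comm, ← brkt_eq_mul hq] at hmain
  have hval : ∑' n : ℤ, x ^ n / (1 - y * q ^ n) =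
      brkt (x * y) q * Eprod q ^ 2 / (brkt x q * brkt y q) := by
    field_simp at hmain ⊢
    linear_combination hmain
  rw [← hval]
  exact hsum.of_norm.hasSum

lemma norm_pow_lt_norm_mul_pow {j m : ℕ} (hq0 : q ≠ 0) (hqx : ‖q‖ < ‖x‖) (hx : ‖x‖ < 1)
    (hj : j < m) : ‖q ^ m‖ < ‖x * q ^ j‖ ∧ ‖x * q ^ j‖ < 1 := by
  have hq : ‖q‖ < 1 := hqx.trans hx
  have hqj : 0 < ‖q‖ ^ j := by positivity
  rw [norm_mul, norm_pow, norm_pow]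
  refine ⟨?_, (mul_le_of_le_one_right (norm_nonneg x)
    (pow_le_one₀ (norm_nonneg q) hq.le)).trans_lt hx⟩
  calc ‖q‖ ^ m ≤ ‖q‖ ^ (j + 1) := pow_le_pow_of_le_one (norm_nonneg q) hq.le hj
    _ = ‖q‖ * ‖q‖ ^ j := pow_succ' _ _
    _ < ‖x‖ * ‖q‖ ^ j := by gcongr

/-- Splitting Kronecker's expansion by `1 / (1 - u) = ∑_{j < m} u ^ j / (1 - u ^ m)`. -/
lemma brkt_mul_div_eq_sum (hq0 : q ≠ 0) (hqx : ‖q‖ < ‖x‖) (hx : ‖x‖ < 1) (hy0 : y ≠ 0)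
    (m : ℕ) (hy : ∀ n : ℤ, (y * q ^ n) ^ m ≠ 1) :
    brkt (x * y) q * Eprod q ^ 2 / (brkt x q * brkt y q) =
      ∑ j ∈ Finset.range m, y ^ j * (brkt (x * q ^ j * y ^ m) (q ^ m) * Eprod (q ^ m) ^ 2 /
        (brkt (x * q ^ j) (q ^ m) * brkt (y ^ m) (q ^ m))) := by
  have hcomm (j : ℕ) (n : ℤ) : (q ^ j) ^ n = (q ^ n) ^ j := by
    rw [← zpow_natCast q j, ← zpow_natCast (q ^ n) j, zpow_comm]
  have hpow (n : ℤ) : y ^ m * (q ^ m) ^ n = (y * q ^ n) ^ m := by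
    rw [mul_pow, hcomm]
  have hy1 (n : ℤ) : y * q ^ n ≠ 1 := fun h ↦ hy n (by rw [h, one_pow])
  have hsplit : HasSum (fun n : ℤ ↦ ∑ j ∈ Finset.range m,
      y ^ j * ((x * q ^ j) ^ n / (1 - y ^ m * (q ^ m) ^ n)))
      (∑ j ∈ Finset.range m, y ^ j * (brkt (x * q ^ j * y ^ m) (q ^ m) * Eprod (q ^ m) ^ 2 /
        (brkt (x * q ^ j) (q ^ m) * brkt (y ^ m) (q ^ m)))) := by
    refine hasSum_sum fun j hj ↦ ?_
    obtain ⟨hj₁, hj₂⟩ := norm_pow_lt_norm_mul_pow hq0 hqx hx (Finset.mem_range.mp hj)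
    exact (hasSum_zpow_div (pow_ne_zero m hq0) hj₁ hj₂ (pow_ne_zero m hy0)
      fun n ↦ by rw [hpow]; exact hy n).mul_left _
  refine (hasSum_zpow_div hq0 hqx hx hy0 hy1).unique (hsplit.congr_fun fun n ↦ ?_)
  have h₁ : 1 - y * q ^ n ≠ 0 := sub_ne_zero.mpr (hy1 n).symm
  have h₂ : 1 - (y * q ^ n) ^ m ≠ 0 := sub_ne_zero.mpr (hy n).symm
  have hterm (j : ℕ) : y ^ j * ((x * q ^ j) ^ n / (1 - y ^ m * (q ^ m) ^ n)) =
      (x ^ n / (1 - (y * q ^ n) ^ m)) * (y * q ^ n) ^ j := by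
    rw [hpow, mul_zpow, hcomm, mul_pow _ _ j]
    ring
  simp only [hterm]
  rw [← Finset.mul_sum, div_mul_eq_mul_div, div_eq_div_iff h₁ h₂, mul_assoc,
    geom_sum_mul_neg]

end Kronecker

section Quintuple

variable {q z : ℂ}

/-- The generalized quintuple product identity on the annulus `‖q‖ < ‖z‖ ^ (a + 1) < 1`. -/
lemma quintuple_of_norm (a : ℕ) (hq0 : q ≠ 0) (hqz : ‖q‖ < ‖z ^ (a + 1)‖) (hz : ‖z‖ < 1) :
    brkt (z ^ a) q / (brkt z q * brkt (z ^ (a + 1)) q) =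
      Eprod (q ^ (a + 1)) ^ 2 / Eprod q ^ 2 *
        ∑ j ∈ Finset.range a,
          z ^ j * brkt (q ^ (a - j)) (q ^ (a + 1)) /
            (brkt (z ^ (a + 1)) (q ^ (a + 1)) *
              brkt (z ^ (a + 1) * q ^ (a - j)) (q ^ (a + 1))) := by
  have hz0 : z ≠ 0 := by
    rintro rfl
    simp at hqz
    exact (norm_nonneg q).not_gt hqz
  have hza : ‖z ^ (a + 1)‖ < 1 := by
    rw [norm_pow]
    exact pow_lt_one₀ (norm_nonneg z) hz a.succ_ne_zero
  have hq : ‖q‖ < 1 := hqz.trans hza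
  have hQ : ‖q ^ (a + 1)‖ < 1 := by
    rw [norm_pow]
    exact pow_lt_one₀ (norm_nonneg q) hq a.succ_ne_zero
  have hqz' : ‖q‖ < ‖z‖ := by
    refine hqz.trans_le ?_
    rw [norm_pow]
    exact pow_le_of_le_one (norm_nonneg z) hz.le a.succ_ne_zero
  have hy (n : ℤ) : (z⁻¹ * q ^ n) ^ (a + 1) ≠ 1 := by
    intro h
    have h1 : ‖z⁻¹ * q ^ n‖ = 1 :=
      (pow_eq_one_iff_of_nonneg (norm_nonneg _) a.succ_ne_zero).mp (by rw [← norm_pow, h, norm_one])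
    have hn : ‖q‖ ^ n = ‖z‖ := by
      rw [norm_mul, norm_inv, norm_zpow] at h1
      field_simp at h1
      exact h1
    have hqpos : 0 < ‖q‖ := norm_pos_iff.mpr hq0
    rcases le_or_gt n 0 with h0 | h0
    · have := one_le_zpow_of_nonpos₀ hqpos hq.le h0
      linarith
    · have := zpow_le_zpow_right_of_le_one₀ hqpos hq.le (show 1 ≤ n by omega)
      rw [zpow_one] at this
      linarith
  have h := brkt_mul_div_eq_sum hq0 hqz hza (inv_ne_zero hz0) (a + 1) hy
  have hxy : z ^ (a + 1) * z⁻¹ = z ^ a := by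
    rw [pow_succ, mul_inv_cancel_right₀ hz0]
  have hxy' (j : ℕ) : z ^ (a + 1) * q ^ j * z⁻¹ ^ (a + 1) = q ^ j := by
    rw [inv_pow]
    field_simp
  have hb := brkt_ne_zero hqz' hz
  have hba := brkt_ne_zero hqz hza
  have hE := Eprod_ne_zero hq
  simp only [hxy, hxy'] at h
  rw [inv_pow z (a + 1), brkt_inv hq hz0, brkt_inv hQ (pow_ne_zero _ hz0), Finset.sum_range_succ',
    pow_zero q, brkt_one, zero_mul, zero_div, mul_zero, add_zero,
    ← Finset.sum_range_reflect] at h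
  have hL : brkt (z ^ a) q / (brkt z q * brkt (z ^ (a + 1)) q) = -z⁻¹ / Eprod q ^ 2 *
      (brkt (z ^ a) q * Eprod q ^ 2 / (brkt (z ^ (a + 1)) q * (-z⁻¹ * brkt z q))) := by
    field_simp
  rw [hL, h, Finset.mul_sum, Finset.mul_sum]
  refine Finset.sum_congr rfl fun j hj ↦ ?_
  obtain ⟨k, rfl⟩ := Nat.exists_eq_add_of_lt (Finset.mem_range.mp hj)
  rw [show j + k + 1 - 1 - j + 1 = k + 1 by omega, show j + k + 1 - j = k + 1 by omega]
  have h1 := norm_pow_lt_norm_mul_pow (j := k + 1) (m := j + k + 1 + 1) hq0 hqz hza (by omega)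
  have h2 := norm_pow_lt_norm_mul_pow (j := 0) (m := j + k + 1 + 1) hq0 hqz hza (by omega)
  rw [pow_zero, mul_one] at h2
  have h1' := brkt_ne_zero h1.1 h1.2
  have h2' := brkt_ne_zero h2.1 h2.2
  rw [inv_pow]
  field_simp
  ring

/-- Clearing denominators in the generalized quintuple product identity. -/
lemma quintuple_iff (a : ℕ) (hq : ‖q‖ < 1)
    (h₁ : brkt z q ≠ 0) (h₂ : brkt (z ^ (a + 1)) q ≠ 0)
    (h₃ : brkt (z ^ (a + 1)) (q ^ (a + 1)) ≠ 0)
    (h₄ : ∀ j < a, brkt (z ^ (a + 1) * q ^ (a - j)) (q ^ (a + 1)) ≠ 0) :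
    brkt (z ^ a) q / (brkt z q * brkt (z ^ (a + 1)) q) =
      Eprod (q ^ (a + 1)) ^ 2 / Eprod q ^ 2 *
        ∑ j ∈ Finset.range a,
          z ^ j * brkt (q ^ (a - j)) (q ^ (a + 1)) /
            (brkt (z ^ (a + 1)) (q ^ (a + 1)) *
              brkt (z ^ (a + 1) * q ^ (a - j)) (q ^ (a + 1))) ↔
    brkt (z ^ a) q * Eprod q ^ 2 * brkt (z ^ (a + 1)) (q ^ (a + 1)) *
        ∏ j ∈ Finset.range a, brkt (z ^ (a + 1) * q ^ (a - j)) (q ^ (a + 1)) =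
      brkt z q * brkt (z ^ (a + 1)) q * Eprod (q ^ (a + 1)) ^ 2 *
        ∑ j ∈ Finset.range a, z ^ j * brkt (q ^ (a - j)) (q ^ (a + 1)) *
          ∏ i ∈ (Finset.range a).erase j, brkt (z ^ (a + 1) * q ^ (a - i)) (q ^ (a + 1)) := by
  have hE := Eprod_ne_zero hq
  have hP : ∏ j ∈ Finset.range a, brkt (z ^ (a + 1) * q ^ (a - j)) (q ^ (a + 1)) ≠ 0 :=
    Finset.prod_ne_zero_iff.mpr fun j hj ↦ h₄ j (Finset.mem_range.mp hj)
  have hsum : ∑ j ∈ Finset.range a, z ^ j * brkt (q ^ (a - j)) (q ^ (a + 1)) *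
        ∏ i ∈ (Finset.range a).erase j, brkt (z ^ (a + 1) * q ^ (a - i)) (q ^ (a + 1)) =
      brkt (z ^ (a + 1)) (q ^ (a + 1)) *
        (∏ j ∈ Finset.range a, brkt (z ^ (a + 1) * q ^ (a - j)) (q ^ (a + 1))) *
        ∑ j ∈ Finset.range a, z ^ j * brkt (q ^ (a - j)) (q ^ (a + 1)) /
          (brkt (z ^ (a + 1)) (q ^ (a + 1)) *
            brkt (z ^ (a + 1) * q ^ (a - j)) (q ^ (a + 1))) := by
    rw [Finset.mul_sum]
    refine Finset.sum_congr rfl fun j hj ↦ ?_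
    have := h₄ j (Finset.mem_range.mp hj)
    rw [← Finset.mul_prod_erase _ _ hj]
    generalize brkt (z ^ (a + 1) * q ^ (a - j)) (q ^ (a + 1)) = B at this ⊢
    field_simp
  rw [hsum]
  generalize (∏ j ∈ Finset.range a, brkt (z ^ (a + 1) * q ^ (a - j)) (q ^ (a + 1))) = P at hP ⊢
  generalize (∑ j ∈ Finset.range a, z ^ j * brkt (q ^ (a - j)) (q ^ (a + 1)) /
    (brkt (z ^ (a + 1)) (q ^ (a + 1)) *
      brkt (z ^ (a + 1) * q ^ (a - j)) (q ^ (a + 1)))) = S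
  rw [div_mul_eq_mul_div, div_eq_div_iff (mul_ne_zero h₁ h₂) (pow_ne_zero 2 hE)]
  have hc : brkt (z ^ (a + 1)) (q ^ (a + 1)) * P ≠ 0 := mul_ne_zero h₃ hP
  rw [← mul_left_inj' hc]
  constructor <;> intro h <;> linear_combination h

lemma quintuple_cleared (a : ℕ) (hq0 : q ≠ 0) (hq : ‖q‖ < 1) (hz : z ≠ 0) :
    brkt (z ^ a) q * Eprod q ^ 2 * brkt (z ^ (a + 1)) (q ^ (a + 1)) *
        ∏ j ∈ Finset.range a, brkt (z ^ (a + 1) * q ^ (a - j)) (q ^ (a + 1)) =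
      brkt z q * brkt (z ^ (a + 1)) q * Eprod (q ^ (a + 1)) ^ 2 *
        ∑ j ∈ Finset.range a, z ^ j * brkt (q ^ (a - j)) (q ^ (a + 1)) *
          ∏ i ∈ (Finset.range a).erase j, brkt (z ^ (a + 1) * q ^ (a - i)) (q ^ (a + 1)) := by
  have hQ : ‖q ^ (a + 1)‖ < 1 := by
    rw [norm_pow]
    exact pow_lt_one₀ (norm_nonneg q) hq a.succ_ne_zero
  have hd {p : ℂ} (hp : ‖p‖ < 1) {c : ℂ} (hc : c ≠ 0) (n : ℕ) :
      DifferentiableOn ℂ (fun w ↦ brkt (w ^ n * c) p) {0}ᶜ :=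
    (differentiableOn_brkt hp).comp (by fun_prop) fun w hw ↦ mul_ne_zero (pow_ne_zero n hw) hc
  have hd' {p : ℂ} (hp : ‖p‖ < 1) (n : ℕ) :
      DifferentiableOn ℂ (fun w ↦ brkt (w ^ n) p) {0}ᶜ := by
    simpa using hd hp one_ne_zero n
  have hdj (j : ℕ) : DifferentiableOn ℂ
      (fun w ↦ brkt (w ^ (a + 1) * q ^ (a - j)) (q ^ (a + 1))) {0}ᶜ :=
    hd hQ (pow_ne_zero _ hq0) _
  obtain ⟨r, hr, hr1, hr0⟩ : ∃ r : ℝ, ‖q‖ < r ^ (a + 1) ∧ r < 1 ∧ 0 < r := by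
    have hc : Tendsto (fun r : ℝ ↦ r ^ (a + 1)) (𝓝[<] 1) (𝓝 1) := by
      simpa using ((continuous_pow (a + 1)).tendsto (1 : ℝ)).mono_left nhdsWithin_le_nhds
    have hlt : ∀ᶠ r : ℝ in 𝓝[<] 1, r < 1 := self_mem_nhdsWithin
    exact ((hc.eventually_const_lt hq).and (hlt.and
      ((eventually_gt_nhds one_pos).filter_mono nhdsWithin_le_nhds))).exists
  have hopen : IsOpen {w : ℂ | ‖q‖ < ‖w ^ (a + 1)‖ ∧ ‖w‖ < 1} := by
    rw [Set.ofPred_and]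
    exact (isOpen_lt (by fun_prop) (by fun_prop)).inter (isOpen_lt (by fun_prop) (by fun_prop))
  have hrmem : (r : ℂ) ∈ {w : ℂ | ‖q‖ < ‖w ^ (a + 1)‖ ∧ ‖w‖ < 1} := by
    simp [abs_of_pos hr0, hr, hr1]
  refine AnalyticOnNhd.eqOn_of_preconnected_of_eventuallyEq (𝕜 := ℂ) (U := {0}ᶜ) (z₀ := (r : ℂ))
    (f := fun w ↦ brkt (w ^ a) q * Eprod q ^ 2 * brkt (w ^ (a + 1)) (q ^ (a + 1)) *
      ∏ j ∈ Finset.range a, brkt (w ^ (a + 1) * q ^ (a - j)) (q ^ (a + 1)))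
    (g := fun w ↦ brkt w q * brkt (w ^ (a + 1)) q * Eprod (q ^ (a + 1)) ^ 2 *
      ∑ j ∈ Finset.range a, w ^ j * brkt (q ^ (a - j)) (q ^ (a + 1)) *
        ∏ i ∈ (Finset.range a).erase j, brkt (w ^ (a + 1) * q ^ (a - i)) (q ^ (a + 1)))
    (DifferentiableOn.analyticOnNhd ?_ isOpen_compl_singleton)
    (DifferentiableOn.analyticOnNhd ?_ isOpen_compl_singleton)
    (isConnected_compl_singleton_of_one_lt_rank (by simp) 0).isPreconnected
    (by simpa using hr0.ne') ?_ hz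
  · exact (((hd' hq a).mul_const _).mul (hd' hQ _)).mul
      (DifferentiableOn.fun_finsetProd fun j _ ↦ hdj j)
  · refine (((differentiableOn_brkt hq).mul (hd' hq _)).mul_const _).mul
      (DifferentiableOn.fun_sum fun j _ ↦ DifferentiableOn.mul (by fun_prop)
        (DifferentiableOn.fun_finsetProd fun i _ ↦ hdj i))
  · filter_upwards [hopen.mem_nhds hrmem] with w ⟨hw, hw1⟩
    have hwa : ‖w ^ (a + 1)‖ < 1 := by
      rw [norm_pow]
      exact pow_lt_one₀ (norm_nonneg w) hw1 a.succ_ne_zero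
    have hqw : ‖q‖ < ‖w‖ := by
      refine hw.trans_le ?_
      rw [norm_pow]
      exact pow_le_of_le_one (norm_nonneg w) hw1.le a.succ_ne_zero
    have hne (j : ℕ) (hj : j < a + 1) : brkt (w ^ (a + 1) * q ^ j) (q ^ (a + 1)) ≠ 0 :=
      brkt_ne_zero (norm_pow_lt_norm_mul_pow hq0 hw hwa hj).1
        (norm_pow_lt_norm_mul_pow hq0 hw hwa hj).2
    refine (quintuple_iff a hq (brkt_ne_zero hqw hw1) (brkt_ne_zero hw hwa) ?_
      fun j _ ↦ hne _ (by omega)).mp (quintuple_of_norm a hq0 hw hw1)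
    simpa using hne 0 a.succ_pos

lemma quintuple_zero (a : ℕ) (h₁ : brkt z 0 ≠ 0) :
    brkt (z ^ a) 0 / (brkt z 0 * brkt (z ^ (a + 1)) 0) =
      Eprod (0 ^ (a + 1)) ^ 2 / Eprod 0 ^ 2 *
        ∑ j ∈ Finset.range a,
          z ^ j * brkt (0 ^ (a - j)) (0 ^ (a + 1)) /
            (brkt (z ^ (a + 1)) (0 ^ (a + 1)) *
              brkt (z ^ (a + 1) * 0 ^ (a - j)) (0 ^ (a + 1))) := by
  have hE : Eprod 0 = 1 := by simp [Eprod]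
  rw [brkt_zero_right] at h₁
  rw [zero_pow a.succ_ne_zero, hE]
  simp only [brkt_zero_right]
  have hterm : ∀ j ∈ Finset.range a, z ^ j * (1 - 0 ^ (a - j)) /
      ((1 - z ^ (a + 1)) * (1 - z ^ (a + 1) * 0 ^ (a - j))) = z ^ j / (1 - z ^ (a + 1)) := by
    intro j hj
    rw [zero_pow (Nat.sub_ne_zero_of_lt (Finset.mem_range.mp hj))]
    simp
  rw [Finset.sum_congr rfl hterm, ← Finset.sum_div, ← geom_sum_mul_neg z a,
    mul_comm (1 - z), mul_div_mul_right _ _ h₁]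
  simp

end Quintuple

/-- Generalization of the quintuple product identity: for a positive integer
`a`, `|q| < 1`, and `z ≠ 0` avoiding the zeros of the denominators,
`[zᵃ;q]_∞ / ([z;q]_∞ [z^{a+1};q]_∞)
 = (E(q^{a+1})²/E(q)²) ∑_{j=0}^{a-1} zʲ [q^{a-j};q^{a+1}]_∞ /
   ([z^{a+1};q^{a+1}]_∞ [z^{a+1}q^{a-j};q^{a+1}]_∞)`. -/
theorem generalized_quintuple_product (a : ℕ) (ha : 0 < a) (z q : ℂ)
    (hz : z ≠ 0) (hq : ‖q‖ < 1)
    (h₁ : brkt z q ≠ 0) (h₂ : brkt (z ^ (a + 1)) q ≠ 0)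
    (h₃ : brkt (z ^ (a + 1)) (q ^ (a + 1)) ≠ 0)
    (h₄ : ∀ j < a, brkt (z ^ (a + 1) * q ^ (a - j)) (q ^ (a + 1)) ≠ 0) :
    brkt (z ^ a) q / (brkt z q * brkt (z ^ (a + 1)) q) =
      Eprod (q ^ (a + 1)) ^ 2 / Eprod q ^ 2 *
        ∑ j ∈ Finset.range a,
          z ^ j * brkt (q ^ (a - j)) (q ^ (a + 1)) /
            (brkt (z ^ (a + 1)) (q ^ (a + 1)) *
              brkt (z ^ (a + 1) * q ^ (a - j)) (q ^ (a + 1))) := by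
  rcases eq_or_ne q 0 with rfl | hq0
  · exact quintuple_zero a h₁
  · exact (quintuple_iff a hq h₁ h₂ h₃ h₄).mpr (quintuple_cleared a hq0 hq hz)
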